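/- Under Assumptions 1 and 3 and with κ ∈ (0,1/2], for any distinct states z^1, z^2 ∈ diag(A) with (z^1, z^2) ∉ E_s (i.e., either more than one player's action differs between z^1 and z^2, or the single differing player i has a_i^2 ∉ C_i(a_i^1)), the minimal resistance over all paths of the PHPIP chain {P^ε} from z^1 to z^2 is at least 2. Consequently, every edge weight of the graph G_R corresponding to a pair in E_s (which is smaller than 3/2) is strictly smaller than every edge weight corresponding to a pair not in E_s. -/

import Mathlib

open Filter Topology Set

attribute [local instance] Classical.propDecidable

section PHPIP

variable {ι : Type*} [Fintype ι] [DecidableEq ι] {A : ι → Type*} [∀ i, Fintype (A i)]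

/-- Assumption 1 on the constraint maps. -/
def Assumption1 (C : ∀ i, A i → Finset (A i)) : Prop :=
  (∀ (i : ι) (a b : A i), b ∈ C i a ↔ a ∈ C i b) ∧
  (∀ (i : ι) (a b : A i), ∃ (nf : ℕ) (f : ℕ → A i), f 0 = a ∧ f nf = b ∧
      ∀ k < nf, f (k + 1) ∈ C i (f k)) ∧
  (∀ (i : ι) (a : A i), 3 ≤ (C i a).card)

/-- Assumption 3: unilateral constrained deviations change the utility by less than 1/2. -/
def Assumption3 (U : ι → (∀ i, A i) → ℝ) (C : ∀ i, A i → Finset (A i)) : Prop :=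
  ∀ (i : ι) (a : ∀ j, A j) (b : A i), b ∈ C i (a i) →
    U i (Function.update a i b) - U i a < 1 / 2

/-- Γ is a constrained potential game with potential function φ. -/
def IsPotentialGame (U : ι → (∀ i, A i) → ℝ) (C : ∀ i, A i → Finset (A i))
    (φ : (∀ i, A i) → ℝ) : Prop :=
  ∀ (i : ι) (a : ∀ j, A j) (b : A i), b ∈ C i (a i) →
    U i (Function.update a i b) - U i a = φ (Function.update a i b) - φ a

/-- Probability that, from state `(a0, a1)`, player `i` selects the action `x`
under the PHPIP selection rule with exploration rate `ε` and parameter `κ`. -/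
noncomputable def selProb (κ : ℝ) (U : ι → (∀ i, A i) → ℝ)
    (C : ∀ i, A i → Finset (A i)) (ε : ℝ) (a0 a1 : ∀ i, A i) (i : ι) (x : A i) : ℝ :=
  if U i a0 ≤ U i a1 then
    (if x = a1 i then 1 - ε else 0) +
      (if x ∈ (C i (a1 i)).erase (a1 i) then
        ε / ((C i (a1 i)).erase (a1 i)).card else 0)
  else
    (if x = a1 i then (1 - ε) * (κ * ε ^ (U i a0 - U i a1)) else 0) +
      (if x = a0 i then (1 - ε) * (1 - κ * ε ^ (U i a0 - U i a1)) else 0) +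
      (if x ∈ ((C i (a1 i)).erase (a1 i)).erase (a0 i) then
        ε / (((C i (a1 i)).erase (a1 i)).erase (a0 i)).card else 0)

/-- One-step transition probability of the Markov chain `{P^ε}` induced by PHPIP
on pairs of joint actions. -/
noncomputable def phTrans (κ : ℝ) (U : ι → (∀ i, A i) → ℝ)
    (C : ∀ i, A i → Finset (A i)) (ε : ℝ)
    (z1 z2 : (∀ i, A i) × (∀ i, A i)) : ℝ :=
  if z2.1 = z1.2 then ∏ i, selProb κ U C ε z1.1 z1.2 i (z2.2 i) else 0

/-- The state space B. -/
def memB (C : ∀ i, A i → Finset (A i)) (z : (∀ i, A i) × (∀ i, A i)) : Prop :=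
  ∀ i, z.2 i ∈ C i (z.1 i)

/-- k-step transition probabilities of the homogeneous chain `{P^ε}`. -/
noncomputable def phTransPow (κ : ℝ) (U : ι → (∀ i, A i) → ℝ)
    (C : ∀ i, A i → Finset (A i)) (ε : ℝ) :
    ℕ → (∀ i, A i) × (∀ i, A i) → (∀ i, A i) × (∀ i, A i) → ℝ
  | 0, z, z' => if z = z' then 1 else 0
  | k + 1, z, z' => ∑ w : (∀ i, A i) × (∀ i, A i),
      phTrans κ U C ε z w * phTransPow κ U C ε k w z'

/-- Probability of a path (sequence of states) of the chain `{P^ε}`. -/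
noncomputable def pathProb (κ : ℝ) (U : ι → (∀ i, A i) → ℝ)
    (C : ∀ i, A i → Finset (A i)) (ε : ℝ) :
    List ((∀ i, A i) × (∀ i, A i)) → ℝ
  | [] => 1
  | [_] => 1
  | z :: z' :: rest => phTrans κ U C ε z z' * pathProb κ U C ε (z' :: rest)

/-- A transition is feasible if it has positive probability for some ε ∈ (0,1/2]. -/
def Feasible (κ : ℝ) (U : ι → (∀ i, A i) → ℝ) (C : ∀ i, A i → Finset (A i))
    (z z' : (∀ i, A i) × (∀ i, A i)) : Prop :=
  ∃ ε : ℝ, 0 < ε ∧ ε ≤ 1 / 2 ∧ 0 < phTrans κ U C ε z z'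

/-- `l` is a (feasible) path of the chain from `z1` to `z2`. -/
def IsPath (κ : ℝ) (U : ι → (∀ i, A i) → ℝ) (C : ∀ i, A i → Finset (A i))
    (z1 z2 : (∀ i, A i) × (∀ i, A i)) (l : List ((∀ i, A i) × (∀ i, A i))) : Prop :=
  l.head? = some z1 ∧ l.getLast? = some z2 ∧ l.Chain' (Feasible κ U C)

/-- `r` is the resistance of the path `l`:  `lim_{ε→0+} P^ε(l)/ε^r ∈ (0,∞)`. -/
def IsPathRes (κ : ℝ) (U : ι → (∀ i, A i) → ℝ) (C : ∀ i, A i → Finset (A i))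
    (l : List ((∀ i, A i) × (∀ i, A i))) (r : ℝ) : Prop :=
  ∃ L : ℝ, 0 < L ∧
    Tendsto (fun ε : ℝ => pathProb κ U C ε l / ε ^ r) (𝓝[>] (0 : ℝ)) (𝓝 L)

/-- `(a, b)` (as diagonal states `((a,a),(b,b))`) is a pair in `E_s`:
exactly one player deviates and the deviation is feasible. -/
def EsPair (C : ∀ i, A i → Finset (A i)) (a b : ∀ i, A i) : Prop :=
  (∃! i, a i ≠ b i) ∧ ∀ i, a i ≠ b i → b i ∈ C i (a i)

/-- The path (list of states) of the M-straight-route through the given diagonal nodes. -/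
def msrPath : List (∀ i, A i) → List ((∀ i, A i) × (∀ i, A i))
  | [] => []
  | [a] => [(a, a)]
  | a :: b :: rest => (a, a) :: (a, b) :: msrPath (b :: rest)

/-- Weight of the edge of the graph `G_R` from `z` to `z'`: the minimal resistance
among all paths of `{P^ε}` from `z` to `z'`. -/
noncomputable def edgeWeight (κ : ℝ) (U : ι → (∀ i, A i) → ℝ)
    (C : ∀ i, A i → Finset (A i)) (z z' : (∀ i, A i) × (∀ i, A i)) : ℝ :=
  sInf {r : ℝ | ∃ l, IsPath κ U C z z' l ∧ IsPathRes κ U C l r}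

/-- `y` is reachable from `x` in at most `d` constraint-feasible steps. -/
def ReachIn (C : ∀ i, A i → Finset (A i)) (i : ι) : ℕ → A i → A i → Prop
  | 0, x, y => x = y
  | d + 1, x, y => ReachIn C i d x y ∨ ∃ w, ReachIn C i d x w ∧ y ∈ C i w

/-- Inhomogeneous products: `transProd κ U C εs k0 m` is the transition matrix
`P(k0, k0 + m) = ∏_{k'=k0}^{k0+m-1} P_{k'}` of the PIPIP chain with exploration
rates `εs`. -/
noncomputable def transProd (κ : ℝ) (U : ι → (∀ i, A i) → ℝ)
    (C : ∀ i, A i → Finset (A i)) (εs : ℕ → ℝ) (k0 : ℕ) :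
    ℕ → (∀ i, A i) × (∀ i, A i) → (∀ i, A i) × (∀ i, A i) → ℝ
  | 0, z, z' => if z = z' then 1 else 0
  | m + 1, z, z' => ∑ w : (∀ i, A i) × (∀ i, A i),
      transProd κ U C εs k0 m z w * phTrans κ U C (εs (k0 + m)) w z'

/-- The PIPIP exploration rate `ε(k) = k^{-1/(n(D+1))}`. -/
noncomputable def pipipRate (n D : ℕ) (k : ℕ) : ℝ :=
  (k : ℝ) ^ (-(1 : ℝ) / ((n : ℝ) * ((D : ℝ) + 1)))

/-- Accessibility along the unperturbed chain `{P^0}`. -/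
def Accessible0 (κ : ℝ) (U : ι → (∀ i, A i) → ℝ) (C : ∀ i, A i → Finset (A i))
    (z z' : (∀ i, A i) × (∀ i, A i)) : Prop :=
  ∃ k : ℕ, 0 < phTransPow κ U C 0 k z z'

/-- A recurrent communication class of the unperturbed chain `{P^0}`. -/
def IsRecClass (κ : ℝ) (U : ι → (∀ i, A i) → ℝ) (C : ∀ i, A i → Finset (A i))
    (H : Set ((∀ i, A i) × (∀ i, A i))) : Prop :=
  H.Nonempty ∧ (∀ z ∈ H, ∀ z' ∈ H, Accessible0 κ U C z z') ∧
    (∀ z ∈ H, ∀ z', Accessible0 κ U C z z' → z' ∈ H)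

end PHPIP

section Resistance

/-- `f` decays at `0` from the right exactly like a positive multiple of `ε ^ r`. -/
def HasResistance (f : ℝ → ℝ) (r : ℝ) : Prop :=
  ∃ L : ℝ, 0 < L ∧ Tendsto (fun ε : ℝ => f ε / ε ^ r) (𝓝[>] (0 : ℝ)) (𝓝 L)

lemma eventually_mem_Ioc_half : ∀ᶠ ε : ℝ in 𝓝[>] (0 : ℝ), 0 < ε ∧ ε ≤ 1 / 2 :=
  Ioc_mem_nhdsGT (by norm_num)

lemma hasResistance_const {c : ℝ} (hc : 0 < c) : HasResistance (fun _ => c) 0 :=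
  ⟨c, hc, by simp⟩

lemma hasResistance_one_sub : HasResistance (fun ε => 1 - ε) 0 := by
  refine ⟨1, one_pos, ?_⟩
  have h : Tendsto (fun ε : ℝ => 1 - ε) (𝓝 0) (𝓝 (1 - 0)) := by
    exact (continuous_const.sub continuous_id).tendsto 0
  simpa using h.mono_left nhdsWithin_le_nhds

lemma hasResistance_rpow (r : ℝ) : HasResistance (fun ε => ε ^ r) r := by
  refine ⟨1, one_pos, tendsto_const_nhds.congr' ?_⟩
  filter_upwards [eventually_mem_Ioc_half] with ε hε
  exact (div_self (Real.rpow_pos_of_pos hε.1 r).ne').symm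

lemma hasResistance_id : HasResistance (fun ε => ε) 1 := by
  simpa using hasResistance_rpow 1

lemma HasResistance.mul {f g : ℝ → ℝ} {r s : ℝ} (hf : HasResistance f r)
    (hg : HasResistance g s) : HasResistance (fun ε => f ε * g ε) (r + s) := by
  obtain ⟨L, hL, hfL⟩ := hf
  obtain ⟨M, hM, hgM⟩ := hg
  refine ⟨L * M, mul_pos hL hM, (hfL.mul hgM).congr' ?_⟩
  filter_upwards [eventually_mem_Ioc_half] with ε hε
  rw [Real.rpow_add hε.1, mul_div_mul_comm]

lemma HasResistance.prod {α : Type*} (s : Finset α) {f : α → ℝ → ℝ} {r : α → ℝ}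
    (h : ∀ i ∈ s, HasResistance (f i) (r i)) :
    HasResistance (fun ε => ∏ i ∈ s, f i ε) (∑ i ∈ s, r i) := by
  classical
  induction s using Finset.induction_on with
  | empty => simpa using hasResistance_const one_pos
  | insert a s ha ih =>
    simp only [Finset.prod_insert ha, Finset.sum_insert ha]
    exact (h a (Finset.mem_insert_self a s)).mul
      (ih fun i hi => h i (Finset.mem_insert_of_mem hi))

lemma HasResistance.eventually_pos {f : ℝ → ℝ} {r : ℝ} (h : HasResistance f r) :
    ∀ᶠ ε in 𝓝[>] (0 : ℝ), 0 < f ε := by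
  obtain ⟨L, hL, hfL⟩ := h
  filter_upwards [eventually_mem_Ioc_half, hfL.eventually (lt_mem_nhds hL)] with ε hε hf
  exact (div_pos_iff_of_pos_right (Real.rpow_pos_of_pos hε.1 r)).1 hf

lemma HasResistance.le_of_le_pow {f : ℝ → ℝ} {r : ℝ} (h : HasResistance f r) (k : ℕ)
    (hf : ∀ ε : ℝ, 0 < ε → ε ≤ 1 / 2 → f ε ≤ ε ^ k) : (k : ℝ) ≤ r := by
  obtain ⟨L, hL, hfL⟩ := h
  by_contra! hr
  have h0 : Tendsto (fun ε : ℝ => ε ^ ((k : ℝ) - r)) (𝓝[>] (0 : ℝ)) (𝓝 0) := by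
    have := (Real.continuousAt_rpow_const 0 ((k : ℝ) - r) (Or.inr (by linarith))).tendsto
    rw [Real.zero_rpow (by linarith)] at this
    exact this.mono_left nhdsWithin_le_nhds
  refine hL.not_ge (le_of_tendsto_of_tendsto hfL h0 ?_)
  filter_upwards [eventually_mem_Ioc_half] with ε hε
  rw [Real.rpow_sub hε.1, Real.rpow_natCast]
  exact div_le_div_of_nonneg_right (hf ε hε.1 hε.2) (Real.rpow_nonneg hε.1.le r)

lemma div_natCast_le_self {ε : ℝ} (hε : 0 < ε) (n : ℕ) : ε / n ≤ ε := by
  rcases Nat.eq_zero_or_pos n with rfl | hn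
  · simpa using hε.le
  · exact div_le_self hε.le (by exact_mod_cast hn)

end Resistance

section PathBounds

variable {ι : Type*} {A : ι → Type*}
  {U : ι → (∀ i, A i) → ℝ} {C : ∀ i, A i → Finset (A i)} {κ ε : ℝ}

lemma selProb_mem_Icc (hκ0 : 0 < κ) (hκ : κ ≤ 1 / 2) (hε0 : 0 < ε) (hε : ε ≤ 1 / 2)
    (a0 a1 : ∀ i, A i) (i : ι) (x : A i) :
    0 ≤ selProb κ U C ε a0 a1 i x ∧ selProb κ U C ε a0 a1 i x ≤ 1 := by
  unfold selProb
  by_cases hU : U i a0 ≤ U i a1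
  · rw [if_pos hU]
    have h1 := div_natCast_le_self hε0 ((C i (a1 i)).erase (a1 i)).card
    have h2 : 0 ≤ ε / ((C i (a1 i)).erase (a1 i)).card := by positivity
    by_cases hx : x = a1 i
    · subst hx
      simp only [if_true, Finset.mem_erase, ne_eq, not_true, false_and, if_false]
      constructor <;> linarith
    · rw [if_neg hx]
      split_ifs <;> constructor <;> linarith
  · rw [if_neg hU]
    have h1 := div_natCast_le_self hε0 (((C i (a1 i)).erase (a1 i)).erase (a0 i)).card
    have h2 : 0 ≤ ε / (((C i (a1 i)).erase (a1 i)).erase (a0 i)).card := by positivity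
    have h3 : 0 ≤ ε ^ (U i a0 - U i a1) := Real.rpow_nonneg hε0.le _
    have h4 : ε ^ (U i a0 - U i a1) ≤ 1 :=
      Real.rpow_le_one hε0.le (by linarith) (by linarith)
    have h5 : 0 ≤ κ * ε ^ (U i a0 - U i a1) := by positivity
    have h6 : κ * ε ^ (U i a0 - U i a1) ≤ 1 := by nlinarith
    generalize κ * ε ^ (U i a0 - U i a1) = q at h5 h6 ⊢
    by_cases hx : x = a1 i
    · have h7 : x ∉ ((C i (a1 i)).erase (a1 i)).erase (a0 i) := by simp [hx]
      rw [if_neg h7]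
      split_ifs <;> constructor <;> nlinarith
    · rw [if_neg hx]
      by_cases hx0 : x = a0 i
      · have h7 : x ∉ ((C i (a1 i)).erase (a1 i)).erase (a0 i) := by simp [hx0]
        rw [if_neg h7, if_pos hx0]
        constructor <;> nlinarith
      · rw [if_neg hx0]
        split_ifs <;> constructor <;> linarith

/-- Moving to an action that is neither kept nor reverted to costs a factor `ε`. -/
lemma selProb_le_of_explore (hε0 : 0 < ε) {a0 a1 : ∀ i, A i} {i : ι} {x : A i}
    (h1 : x ≠ a1 i) (h0 : x ≠ a0 i) : selProb κ U C ε a0 a1 i x ≤ ε := by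
  unfold selProb
  simp only [if_neg h1, if_neg h0, zero_add]
  split_ifs
  · exact div_natCast_le_self hε0 _
  · exact hε0.le
  · exact div_natCast_le_self hε0 _
  · exact hε0.le

lemma selProb_eq_zero_of_notMem {a : ∀ i, A i} {i : ι} {x : A i} (hx : x ≠ a i)
    (hC : x ∉ C i (a i)) : selProb κ U C ε a a i x = 0 := by
  simp [selProb, hx, hC]

lemma selProb_hasResistance_stay {a0 a1 : ∀ i, A i} {i : ι}
    (h : U i a0 ≤ U i a1 ∨ a0 i = a1 i) :
    HasResistance (fun ε => selProb κ U C ε a0 a1 i (a1 i)) 0 := by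
  have : (fun ε => selProb κ U C ε a0 a1 i (a1 i)) = fun ε => 1 - ε := by
    funext ε
    by_cases hU : U i a0 ≤ U i a1
    · simp [selProb, hU]
    · simp only [selProb, if_neg hU, (h.resolve_left hU), Finset.mem_erase]
      simp
      ring
  exact this ▸ hasResistance_one_sub

lemma selProb_hasResistance_keep_worse (hκ0 : 0 < κ) {a0 a1 : ∀ i, A i} {i : ι}
    (h : U i a1 < U i a0) (hne : a1 i ≠ a0 i) :
    HasResistance (fun ε => selProb κ U C ε a0 a1 i (a1 i)) (U i a0 - U i a1) := by
  have := hasResistance_one_sub.mul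
    ((hasResistance_const hκ0).mul (hasResistance_rpow (U i a0 - U i a1)))
  simpa [selProb, h.not_ge, hne] using this

lemma selProb_hasResistance_explore {a : ∀ i, A i} {i : ι} {x : A i}
    (hx : x ∈ C i (a i)) (hne : x ≠ a i) :
    HasResistance (fun ε => selProb κ U C ε a a i x) 1 := by
  have hmem : x ∈ (C i (a i)).erase (a i) := Finset.mem_erase.2 ⟨hne, hx⟩
  have hc : (0 : ℝ) < ((C i (a i)).erase (a i)).card := by
    exact_mod_cast Finset.card_pos.2 ⟨x, hmem⟩
  have := hasResistance_id.mul (hasResistance_const (inv_pos.2 hc))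
  simpa only [selProb, le_refl, if_true, if_neg hne, if_pos hmem, zero_add, div_eq_mul_inv,
    add_zero] using this

variable [Fintype ι]

lemma phTrans_nonneg (hκ0 : 0 < κ) (hκ : κ ≤ 1 / 2) (hε0 : 0 < ε) (hε : ε ≤ 1 / 2)
    (z w : (∀ i, A i) × (∀ i, A i)) : 0 ≤ phTrans κ U C ε z w := by
  unfold phTrans
  split_ifs
  · exact Finset.prod_nonneg fun i _ => (selProb_mem_Icc hκ0 hκ hε0 hε _ _ _ _).1
  · exact le_rfl

/-- The product of selection probabilities is at most the product over any set of players. -/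
lemma phTrans_le_prod (hκ0 : 0 < κ) (hκ : κ ≤ 1 / 2) (hε0 : 0 < ε) (hε : ε ≤ 1 / 2)
    (z w : (∀ i, A i) × (∀ i, A i)) (s : Finset ι) :
    phTrans κ U C ε z w ≤ ∏ i ∈ s, selProb κ U C ε z.1 z.2 i (w.2 i) := by
  have h := fun i => selProb_mem_Icc (U := U) (C := C) hκ0 hκ hε0 hε z.1 z.2 i (w.2 i)
  unfold phTrans
  split_ifs
  · exact Finset.prod_le_prod_of_subset_of_le_one (Finset.subset_univ s)
      (fun i _ => (h i).1) (fun i _ _ => (h i).2)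
  · exact Finset.prod_nonneg fun i _ => (h i).1

lemma phTrans_le_pow (hκ0 : 0 < κ) (hκ : κ ≤ 1 / 2) (hε0 : 0 < ε) (hε : ε ≤ 1 / 2)
    (z w : (∀ i, A i) × (∀ i, A i)) (s : Finset ι)
    (hs : ∀ i ∈ s, w.2 i ≠ z.2 i ∧ w.2 i ≠ z.1 i) :
    phTrans κ U C ε z w ≤ ε ^ s.card := by
  refine (phTrans_le_prod hκ0 hκ hε0 hε z w s).trans ?_
  rw [← Finset.prod_const]
  exact Finset.prod_le_prod (fun i _ => (selProb_mem_Icc hκ0 hκ hε0 hε _ _ _ _).1)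
    fun i hi => selProb_le_of_explore hε0 (hs i hi).1 (hs i hi).2

lemma phTrans_le_of_explore (hκ0 : 0 < κ) (hκ : κ ≤ 1 / 2) (hε0 : 0 < ε) (hε : ε ≤ 1 / 2)
    {z w : (∀ i, A i) × (∀ i, A i)} {i : ι} (h : w.2 i ≠ z.2 i ∧ w.2 i ≠ z.1 i) :
    phTrans κ U C ε z w ≤ ε := by
  simpa using phTrans_le_pow hκ0 hκ hε0 hε z w {i} (by simpa using h)

lemma phTrans_le_one (hκ0 : 0 < κ) (hκ : κ ≤ 1 / 2) (hε0 : 0 < ε) (hε : ε ≤ 1 / 2)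
    (z w : (∀ i, A i) × (∀ i, A i)) : phTrans κ U C ε z w ≤ 1 := by
  simpa using phTrans_le_pow hκ0 hκ hε0 hε z w ∅ (by simp)

lemma phTrans_eq_zero_of_ne {z w : (∀ i, A i) × (∀ i, A i)} (h : w.1 ≠ z.2) :
    phTrans κ U C ε z w = 0 := if_neg h

lemma pathProb_mem_Icc (hκ0 : 0 < κ) (hκ : κ ≤ 1 / 2) (hε0 : 0 < ε) (hε : ε ≤ 1 / 2)
    (l : List ((∀ i, A i) × (∀ i, A i))) :
    0 ≤ pathProb κ U C ε l ∧ pathProb κ U C ε l ≤ 1 := by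
  induction l with
  | nil => simp [pathProb]
  | cons z t ih =>
    cases t with
    | nil => simp [pathProb]
    | cons w t =>
      exact ⟨mul_nonneg (phTrans_nonneg hκ0 hκ hε0 hε z w) ih.1,
        mul_le_one₀ (phTrans_le_one hκ0 hκ hε0 hε z w) ih.1 ih.2⟩

/-- A path from a pair of joint actions which avoids `a'` and in which at most one player
changes needs at least one exploration to arrive at `(a', a')`. -/
lemma pathProb_le_of_single_deviation (hκ0 : 0 < κ) (hκ : κ ≤ 1 / 2) (hε0 : 0 < ε)
    (hε : ε ≤ 1 / 2) (a' : ∀ i, A i) (l : List ((∀ i, A i) × (∀ i, A i)))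
    (z : (∀ i, A i) × (∀ i, A i)) (h1 : z.1 ≠ a') (h2 : z.2 ≠ a') (i : ι)
    (hi : ∀ j, j ≠ i → z.1 j = z.2 j) (hl : (z :: l).getLast? = some (a', a')) :
    pathProb κ U C ε (z :: l) ≤ ε := by
  induction l generalizing z with
  | nil => simp at hl; simp [hl] at h1
  | cons w t ih =>
    rw [List.getLast?_cons_cons] at hl
    change phTrans κ U C ε z w * pathProb κ U C ε (w :: t) ≤ ε
    have hP := phTrans_le_one (U := U) (C := C) hκ0 hκ hε0 hε z w
    have hP0 := phTrans_nonneg (U := U) (C := C) hκ0 hκ hε0 hε z w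
    obtain ⟨hQ0, hQ⟩ := pathProb_mem_Icc (U := U) (C := C) hκ0 hκ hε0 hε (w :: t)
    by_cases hw : w.1 = z.2
    swap
    · rw [phTrans_eq_zero_of_ne hw, zero_mul]; exact hε0.le
    by_cases hex : ∃ j, w.2 j ≠ z.2 j ∧ w.2 j ≠ z.1 j
    · obtain ⟨j, hj⟩ := hex
      exact (mul_le_of_le_one_right hP0 hQ).trans
        (phTrans_le_of_explore hκ0 hκ hε0 hε hj)
    · push Not at hex
      have hoff : ∀ j, j ≠ i → w.2 j = z.2 j := fun j hj => by
        by_contra hne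
        exact hne ((hex j hne).trans (hi j hj))
      refine (mul_le_of_le_one_left hQ0 hP).trans (ih w (hw ▸ h2) ?_ (fun j hj => ?_) hl)
      · by_cases hwi : w.2 i = z.2 i
        · have : w.2 = z.2 := funext fun j => by
            by_cases hj : j = i
            · exact hj ▸ hwi
            · exact hoff j hj
          exact this ▸ h2
        · have : w.2 = z.1 := funext fun j => by
            by_cases hj : j = i
            · exact hj ▸ hex i hwi
            · exact (hoff j hj).trans (hi j hj).symm
          exact this ▸ h1
      · rw [hw, hoff j hj]

lemma pathProb_le_sq (hκ0 : 0 < κ) (hκ : κ ≤ 1 / 2) (hε0 : 0 < ε)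
    (hε : ε ≤ 1 / 2) {a a' : ∀ i, A i} (hne : a ≠ a') (hE : ¬ EsPair C a a')
    (l : List ((∀ i, A i) × (∀ i, A i))) (hl : ((a, a) :: l).getLast? = some (a', a')) :
    pathProb κ U C ε ((a, a) :: l) ≤ ε ^ 2 := by
  induction l with
  | nil => simp at hl; exact absurd hl hne
  | cons w t ih =>
    rw [List.getLast?_cons_cons] at hl
    change phTrans κ U C ε (a, a) w * pathProb κ U C ε (w :: t) ≤ ε ^ 2
    have hP := phTrans_le_one (U := U) (C := C) hκ0 hκ hε0 hε (a, a) w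
    have hP0 := phTrans_nonneg (U := U) (C := C) hκ0 hκ hε0 hε (a, a) w
    obtain ⟨hQ0, hQ⟩ := pathProb_mem_Icc (U := U) (C := C) hκ0 hκ hε0 hε (w :: t)
    obtain ⟨w1, b⟩ := w
    by_cases hw : w1 = a
    swap
    · rw [phTrans_eq_zero_of_ne hw, zero_mul]; positivity
    subst hw
    by_cases hba : b = w1
    · subst hba
      exact (mul_le_of_le_one_left hQ0 hP).trans (ih hl)
    obtain ⟨i, hi⟩ := Function.ne_iff.1 hba
    by_cases hex : ∃ j, j ≠ i ∧ b j ≠ w1 j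
    · obtain ⟨j, hji, hj⟩ := hex
      refine (mul_le_of_le_one_right hP0 hQ).trans ?_
      rw [← Finset.card_pair hji]
      refine phTrans_le_pow hκ0 hκ hε0 hε _ _ _ fun k hk => ?_
      rcases Finset.mem_insert.1 hk with rfl | hk
      · exact ⟨hj, hj⟩
      · rw [Finset.mem_singleton.1 hk]
        exact ⟨hi, hi⟩
    push Not at hex
    by_cases hC : b i ∈ C i (w1 i)
    · have hb : b ≠ a' := by
        rintro rfl
        refine hE ⟨⟨i, hi.symm, fun j hj => ?_⟩, fun j hj => ?_⟩
        · by_contra hji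
          exact hj (hex j hji).symm
        · by_cases hji : j = i
          · exact hji ▸ hC
          · exact absurd (hex j hji).symm hj
      rw [sq]
      exact mul_le_mul (phTrans_le_of_explore (i := i) hκ0 hκ hε0 hε ⟨hi, hi⟩)
        (pathProb_le_of_single_deviation hκ0 hκ hε0 hε a' t (w1, b) hne hb i
          (fun j hj => (hex j hj).symm) hl) hQ0 hε0.le
    · have h0 := phTrans_le_prod (U := U) (C := C) hκ0 hκ hε0 hε (w1, w1) (w1, b) {i}
      rw [Finset.prod_singleton, selProb_eq_zero_of_notMem hi hC] at h0
      exact (mul_nonpos_of_nonpos_of_nonneg h0 hQ0).trans (by positivity)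

end PathBounds

section Routes

variable {ι : Type*} [Fintype ι] {A : ι → Type*}
  {U : ι → (∀ i, A i) → ℝ} {C : ∀ i, A i → Finset (A i)} {κ : ℝ}

lemma IsPath.eq_cons {z z' : (∀ i, A i) × (∀ i, A i)} {l : List ((∀ i, A i) × (∀ i, A i))}
    (h : IsPath κ U C z z' l) : ∃ t, l = z :: t :=
  ⟨l.tail, List.eq_cons_of_mem_head? h.1⟩

lemma IsPathRes.nonneg (hκ0 : 0 < κ) (hκ : κ ≤ 1 / 2)
    {l : List ((∀ i, A i) × (∀ i, A i))} {r : ℝ} (h : IsPathRes κ U C l r) : 0 ≤ r := by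
  simpa using HasResistance.le_of_le_pow h 0 fun ε hε0 hε => by
    simpa using (pathProb_mem_Icc hκ0 hκ hε0 hε l).2

lemma IsPathRes.two_le (hκ0 : 0 < κ) (hκ : κ ≤ 1 / 2) {a a' : ∀ i, A i} (hne : a ≠ a')
    (hE : ¬ EsPair C a a') {l : List ((∀ i, A i) × (∀ i, A i))} {r : ℝ}
    (hl : IsPath κ U C (a, a) (a', a') l) (h : IsPathRes κ U C l r) : 2 ≤ r := by
  obtain ⟨t, rfl⟩ := hl.eq_cons
  exact_mod_cast HasResistance.le_of_le_pow h 2 fun ε hε0 hε =>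
    pathProb_le_sq hκ0 hκ hε0 hε hne hE t hl.2.1

/-- Every transition with a resistance is feasible. -/
lemma feasible_of_hasResistance {z w : (∀ i, A i) × (∀ i, A i)} {r : ℝ}
    (h : HasResistance (fun ε => phTrans κ U C ε z w) r) : Feasible κ U C z w := by
  obtain ⟨ε, hε, hpos⟩ := (eventually_mem_Ioc_half.and h.eventually_pos).exists
  exact ⟨ε, hε.1, hε.2, hpos⟩

lemma phTrans_hasResistance {a0 a1 b : ∀ i, A i} {r : ι → ℝ}
    (h : ∀ i, HasResistance (fun ε => selProb κ U C ε a0 a1 i (b i)) (r i)) :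
    HasResistance (fun ε => phTrans κ U C ε (a0, a1) (a1, b)) (∑ i, r i) := by
  simpa [phTrans] using HasResistance.prod Finset.univ fun i _ => h i

/-- There is a path from `z` to `z'` with resistance `r`. -/
def HasPathRes (κ : ℝ) (U : ι → (∀ i, A i) → ℝ) (C : ∀ i, A i → Finset (A i))
    (z z' : (∀ i, A i) × (∀ i, A i)) (r : ℝ) : Prop :=
  ∃ l, IsPath κ U C z z' l ∧ IsPathRes κ U C l r

lemma HasPathRes.refl (z : (∀ i, A i) × (∀ i, A i)) : HasPathRes κ U C z z 0 :=
  ⟨[z], ⟨rfl, rfl, List.isChain_singleton z⟩, hasResistance_const one_pos⟩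

lemma HasPathRes.cons {z w z' : (∀ i, A i) × (∀ i, A i)} {r s : ℝ}
    (h : HasResistance (fun ε => phTrans κ U C ε z w) r) (hw : HasPathRes κ U C w z' s) :
    HasPathRes κ U C z z' (r + s) := by
  obtain ⟨l, hl, hs⟩ := hw
  obtain ⟨t, rfl⟩ := hl.eq_cons
  refine ⟨z :: w :: t, ⟨rfl, ?_, ?_⟩, HasResistance.mul h hs⟩
  · rw [List.getLast?_cons_cons]; exact hl.2.1
  · exact List.isChain_cons_cons.2 ⟨feasible_of_hasResistance h, hl.2.2⟩

variable [DecidableEq ι]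

/-- The straight route through one feasible unilateral deviation. -/
lemma HasPathRes.cons_update (hκ0 : 0 < κ) {a : ∀ i, A i} {i : ι} {x : A i}
    (hx : x ∈ C i (a i)) (hne : x ≠ a i) {z : (∀ i, A i) × (∀ i, A i)} {r : ℝ}
    (h : HasPathRes κ U C (Function.update a i x, Function.update a i x) z r) :
    HasPathRes κ U C (a, a) z (1 + (max 0 (U i a - U i (Function.update a i x)) + r)) := by
  set b := Function.update a i x with hb
  have hbi : b i = x := Function.update_self i x a
  have hbj : ∀ j, j ≠ i → b j = a j := fun j hj => Function.update_of_ne hj x a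
  refine HasPathRes.cons (w := (a, b)) ?_ (HasPathRes.cons ?_ h)
  · have := phTrans_hasResistance (κ := κ) (U := U) (C := C) (a0 := a) (a1 := a) (b := b)
      (r := fun j => if j = i then 1 else 0) fun j => ?_
    · simpa using this
    · by_cases hj : j = i
      · subst hj
        simpa [hbi] using selProb_hasResistance_explore hx hne
      · simpa [hj, hbj j hj] using selProb_hasResistance_stay (Or.inr rfl)
  · have := phTrans_hasResistance (κ := κ) (U := U) (C := C) (a0 := a) (a1 := b) (b := b)
      (r := fun j => if j = i then max 0 (U i a - U i b) else 0) fun j => ?_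
    · simpa using this
    · by_cases hj : j = i
      · subst hj
        rw [if_pos rfl]
        rcases le_or_gt (U j a) (U j b) with hU | hU
        · rw [max_eq_left (by linarith)]
          exact selProb_hasResistance_stay (Or.inl hU)
        · rw [max_eq_right (by linarith)]
          exact selProb_hasResistance_keep_worse hκ0 hU (hbi ▸ hne)
      · rw [if_neg hj]
        exact selProb_hasResistance_stay (Or.inr (hbj j hj).symm)

/-- Any unilateral change of action can be prepended to a path. -/
lemma exists_hasPathRes_update (hκ0 : 0 < κ) (hA1 : Assumption1 C) (a : ∀ i, A i) (i : ι)
    (x : A i) {z : (∀ i, A i) × (∀ i, A i)}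
    (h : ∃ r, HasPathRes κ U C (Function.update a i x, Function.update a i x) z r) :
    ∃ r, HasPathRes κ U C (a, a) z r := by
  obtain ⟨n, f, hf0, hfn, hf⟩ := hA1.2.1 i (a i) x
  have key : ∀ k ≤ n, (∃ r, HasPathRes κ U C
      (Function.update a i (f k), Function.update a i (f k)) z r) →
      ∃ r, HasPathRes κ U C (a, a) z r := by
    intro k
    induction k with
    | zero => intro _ h; simpa [hf0] using h
    | succ k ih =>
      rintro hk ⟨r, hr⟩
      refine ih (by omega) ?_
      by_cases he : f (k + 1) = f k
      · exact ⟨r, he ▸ hr⟩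
      · refine ⟨_, HasPathRes.cons_update hκ0 (i := i) (x := f (k + 1)) (r := r) ?_ ?_ ?_⟩
        · simpa using hf k hk
        · simpa using he
        · simpa using hr
  exact key n le_rfl (hfn ▸ h)

lemma exists_hasPathRes (hκ0 : 0 < κ) (hA1 : Assumption1 C) (a b : ∀ i, A i) :
    ∃ r, HasPathRes κ U C (a, a) (b, b) r := by
  have key : ∀ s : Finset ι,
      (∃ r, HasPathRes κ U C (s.piecewise b a, s.piecewise b a) (b, b) r) →
      ∃ r, HasPathRes κ U C (a, a) (b, b) r := by
    intro s
    induction s using Finset.induction_on with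
    | empty => simp
    | insert i s _ ih =>
      intro h
      rw [Finset.piecewise_insert] at h
      exact ih (exists_hasPathRes_update hκ0 hA1 _ i (b i) h)
  exact key Finset.univ ⟨0, by simpa using HasPathRes.refl (b, b)⟩

lemma edgeWeight_lt_of_esPair (hκ0 : 0 < κ) (hκ : κ ≤ 1 / 2) (hA1 : Assumption1 C)
    (hA3 : Assumption3 U C) {a b : ∀ i, A i} (h : EsPair C a b) :
    edgeWeight κ U C (a, a) (b, b) < 3 / 2 := by
  obtain ⟨⟨i, hi, huniq⟩, hC⟩ := h
  have hb : Function.update a i (b i) = b := by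
    funext j
    by_cases hj : j = i
    · subst hj; simp
    · rw [Function.update_of_ne hj]
      by_contra hne
      exact hj (huniq j hne)
  have ha : Function.update b i (a i) = a := by
    rw [← hb]; simp
  have hpath := HasPathRes.cons_update (U := U) hκ0 (hC i hi) (Ne.symm hi)
    (hb.symm ▸ HasPathRes.refl (b, b))
  rw [hb] at hpath
  have hU := hA3 i b (a i) ((hA1.1 i _ _).1 (hC i hi))
  rw [ha] at hU
  have hbdd : BddBelow {r | HasPathRes κ U C (a, a) (b, b) r} :=
    ⟨0, fun _ ⟨_, _, hr⟩ => hr.nonneg hκ0 hκ⟩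
  refine (csInf_le hbdd hpath).trans_lt ?_
  have : max 0 (U i a - U i b) < 1 / 2 := max_lt (by norm_num) hU
  linarith

lemma two_le_edgeWeight (hκ0 : 0 < κ) (hκ : κ ≤ 1 / 2) (hA1 : Assumption1 C)
    {a b : ∀ i, A i} (hne : a ≠ b) (hE : ¬ EsPair C a b) :
    2 ≤ edgeWeight κ U C (a, a) (b, b) :=
  le_csInf (exists_hasPathRes hκ0 hA1 a b) fun _ ⟨_, hl, hr⟩ => hr.two_le hκ0 hκ hne hE hl

end Routes

section Theorems

variable {ι : Type*} [Fintype ι] [DecidableEq ι] {A : ι → Type*} [∀ i, Fintype (A i)]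

theorem statement13
    (U : ι → (∀ i, A i) → ℝ) (C : ∀ i, A i → Finset (A i))
    (κ : ℝ) (hκ0 : 0 < κ) (hκ : κ ≤ 1 / 2)
    (hA1 : Assumption1 C) (hA3 : Assumption3 U C) :
    (∀ a1 a2 : ∀ i, A i, a1 ≠ a2 → ¬ EsPair C a1 a2 →
      ∀ (l : List ((∀ i, A i) × (∀ i, A i))) (r : ℝ),
        IsPath κ U C (a1, a1) (a2, a2) l → IsPathRes κ U C l r → 2 ≤ r) ∧
    (∀ b1 b2 c1 c2 : ∀ i, A i, EsPair C b1 b2 → c1 ≠ c2 → ¬ EsPair C c1 c2 →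
      edgeWeight κ U C (b1, b1) (b2, b2) < 3 / 2 ∧
      edgeWeight κ U C (b1, b1) (b2, b2) < edgeWeight κ U C (c1, c1) (c2, c2)) := by
  refine ⟨fun a1 a2 hne hE l r hl hr => hr.two_le hκ0 hκ hne hE hl,
    fun b1 b2 c1 c2 hb hc hE => ?_⟩
  have h1 := edgeWeight_lt_of_esPair hκ0 hκ hA1 hA3 hb
  have h2 := two_le_edgeWeight (U := U) hκ0 hκ hA1 hc hE
  exact ⟨h1, by linarith⟩

end Theorems
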